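/- Under the stated abstract polarity assumptions, the following duality relations hold: (i) for every (x,q) ∈ K, the set C(x,q) contains a P⊗dκ-a.e. strictly positive process, and a nonnegative jointly measurable process c belongs to C(x,q) if and only if ⟨c,δ⟩ ≤ xy + qr for all (y,r) ∈ L* and δ ∈ D(y,r); (ii) for every (y,r) ∈ L*, the set D(y,r) contains a P⊗dκ-a.e. strictly positive process, and a nonnegative jointly measurable process δ belongs to D(y,r) if and only if ⟨c,δ⟩ ≤ xy + qr for all (x,q) ∈ K and c ∈ C(x,q). -/

import Mathlib

open MeasureTheory ENNReal Filter Set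

noncomputable section

/-- The time interval `[0, T̂)` for a horizon `T̂ ∈ (0,∞]`, encoded as an `EReal`. -/
def timeSet (That : EReal) : Set ℝ := {t : ℝ | 0 ≤ t ∧ (t : EReal) < That}

variable {Ω : Type*}

/-- The measure `P ⊗ dκ` on `Ω × [0,T̂)`. -/
def Pkappa [MeasurableSpace Ω] (P : Measure Ω) (That : EReal) (kdot : Ω → ℝ → ℝ) :
    Measure (Ω × ℝ) :=
  (P.prod (volume.restrict (timeSet That))).withDensity fun p => ENNReal.ofReal (kdot p.1 p.2)

/-- `⟨c, δ⟩ = E[∫_0^T̂ c_t δ_t dκ_t]` for real-valued processes. -/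
def pairR [MeasurableSpace Ω] (P : Measure Ω) (That : EReal) (kdot : Ω → ℝ → ℝ)
    (c δ : Ω → ℝ → ℝ) : ℝ≥0∞ :=
  ∫⁻ ω, ∫⁻ t in timeSet That,
    ENNReal.ofReal (c ω t) * ENNReal.ofReal (δ ω t) * ENNReal.ofReal (kdot ω t) ∂volume ∂P

lemma pairR_eq_lintegral [MeasurableSpace Ω] (P : Measure Ω) (That : EReal)
    {kdot c δ : Ω → ℝ → ℝ} (hk : Measurable (Function.uncurry kdot))
    (hc : Measurable (Function.uncurry c)) (hδ : Measurable (Function.uncurry δ)) :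
    pairR P That kdot c δ =
      ∫⁻ z, ENNReal.ofReal (c z.1 z.2) * ENNReal.ofReal (δ z.1 z.2) ∂(Pkappa P That kdot) := by
  have hk' : Measurable fun z : Ω × ℝ => ENNReal.ofReal (kdot z.1 z.2) := hk.ennreal_ofReal
  have hc' : Measurable fun z : Ω × ℝ => ENNReal.ofReal (c z.1 z.2) := hc.ennreal_ofReal
  have hδ' : Measurable fun z : Ω × ℝ => ENNReal.ofReal (δ z.1 z.2) := hδ.ennreal_ofReal
  have hcδ : Measurable fun z : Ω × ℝ =>
      ENNReal.ofReal (c z.1 z.2) * ENNReal.ofReal (δ z.1 z.2) := hc'.mul hδ'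
  rw [Pkappa, lintegral_withDensity_eq_lintegral_mul _ hk' hcδ,
    lintegral_prod _ (hk'.mul hcδ).aemeasurable]
  simp only [pairR, Pi.mul_apply]
  refine lintegral_congr fun ω => lintegral_congr fun t => ?_
  ring

lemma pairR_mono [MeasurableSpace Ω] (P : Measure Ω) (That : EReal) (kdot : Ω → ℝ → ℝ)
    {c c' δ δ' : Ω → ℝ → ℝ} (hc : ∀ ω t, c ω t ≤ c' ω t) (hδ : ∀ ω t, δ ω t ≤ δ' ω t) :
    pairR P That kdot c δ ≤ pairR P That kdot c' δ' := by
  unfold pairR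
  gcongr with ω t
  · exact hc ω t
  · exact hδ ω t

lemma pairR_smul_left [MeasurableSpace Ω] (P : Measure Ω) (That : EReal)
    (kdot c δ : Ω → ℝ → ℝ) {a : ℝ} (ha : 0 ≤ a) :
    pairR P That kdot (fun ω t => a * c ω t) δ =
      ENNReal.ofReal a * pairR P That kdot c δ := by
  simp only [pairR, ENNReal.ofReal_mul ha, mul_assoc]
  simp only [lintegral_const_mul' _ _ ENNReal.ofReal_ne_top]

lemma pairR_smul_right [MeasurableSpace Ω] (P : Measure Ω) (That : EReal)
    (kdot c δ : Ω → ℝ → ℝ) {a : ℝ} (ha : 0 ≤ a) :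
    pairR P That kdot c (fun ω t => a * δ ω t) =
      ENNReal.ofReal a * pairR P That kdot c δ := by
  simp only [pairR, ENNReal.ofReal_mul ha, mul_assoc, mul_left_comm _ (ENNReal.ofReal a)]
  simp only [lintegral_const_mul' _ _ ENNReal.ofReal_ne_top]

lemma pairR_add_right [MeasurableSpace Ω] (P : Measure Ω) (That : EReal)
    {kdot c δ δ' : Ω → ℝ → ℝ} (hk : Measurable (Function.uncurry kdot))
    (hc : Measurable (Function.uncurry c))
    (hδ : Measurable (Function.uncurry δ)) (hδ' : Measurable (Function.uncurry δ'))
    (hδ0 : ∀ ω t, 0 ≤ δ ω t) (hδ'0 : ∀ ω t, 0 ≤ δ' ω t) :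
    pairR P That kdot c (fun ω t => δ ω t + δ' ω t) =
      pairR P That kdot c δ + pairR P That kdot c δ' := by
  have hs : Measurable (Function.uncurry fun ω t => δ ω t + δ' ω t) := hδ.add hδ'
  rw [pairR_eq_lintegral P That hk hc hs, pairR_eq_lintegral P That hk hc hδ,
    pairR_eq_lintegral P That hk hc hδ', ← lintegral_add_left]
  · refine lintegral_congr fun z => ?_
    rw [ENNReal.ofReal_add (hδ0 _ _) (hδ'0 _ _), mul_add]
  · exact hc.ennreal_ofReal.mul hδ.ennreal_ofReal

/-- If `c ∨ m` is admissible against a dominating `δ + η` then the mass of `η` can be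
subtracted from the budget of `c` against `δ`. -/
lemma pairR_le_sub_of_add [MeasurableSpace Ω] (P : Measure Ω) (That : EReal)
    {kdot c δ η : Ω → ℝ → ℝ} (hk : Measurable (Function.uncurry kdot))
    (hc : Measurable (Function.uncurry c))
    (hδ : Measurable (Function.uncurry δ)) (hη : Measurable (Function.uncurry η))
    (hδ0 : ∀ ω t, 0 ≤ δ ω t) (hη0 : ∀ ω t, 0 ≤ η ω t)
    {m b B : ℝ} (hm : 0 ≤ m) (hb : 0 ≤ b)
    (hB : pairR P That kdot (fun ω t => max (c ω t) m) (fun ω t => δ ω t + η ω t) ≤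
      ENNReal.ofReal B)
    (hbη : ENNReal.ofReal b ≤ pairR P That kdot (fun _ _ => 1) η) :
    pairR P That kdot c δ ≤ ENNReal.ofReal (B - m * b) := by
  have hmax : Measurable (Function.uncurry fun ω t => max (c ω t) m) := hc.max measurable_const
  rw [pairR_add_right P That hk hmax hδ hη hδ0 hη0] at hB
  rw [ENNReal.ofReal_sub _ (mul_nonneg hm hb)]
  refine ENNReal.le_sub_of_add_le_right ENNReal.ofReal_ne_top (le_trans ?_ hB)
  gcongr
  · exact pairR_mono P That kdot (fun ω t => le_max_left _ _) fun _ _ => le_rfl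
  · rw [ENNReal.ofReal_mul hm]
    calc ENNReal.ofReal m * ENNReal.ofReal b
        ≤ ENNReal.ofReal m * pairR P That kdot (fun _ _ => 1) η := by gcongr
      _ = pairR P That kdot (fun _ _ => m * 1) η := (pairR_smul_left P That kdot _ _ hm).symm
      _ ≤ _ := pairR_mono P That kdot (fun ω t => by simp) fun _ _ => le_rfl

/-- Splitting `⟨c ∨ m, δ⟩` along the set where `c` exceeds `m`. -/
lemma pairR_max_eq [MeasurableSpace Ω] (P : Measure Ω) (That : EReal)
    {kdot c δ : Ω → ℝ → ℝ} (hk : Measurable (Function.uncurry kdot))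
    (hc : Measurable (Function.uncurry c)) (hδ : Measurable (Function.uncurry δ))
    {m : ℝ} (hm : 0 ≤ m) :
    pairR P That kdot (fun ω t => max (c ω t) m) δ =
      pairR P That kdot c (fun ω t => if m ≤ c ω t then δ ω t else 0) +
        ENNReal.ofReal m *
          pairR P That kdot (fun _ _ => 1) (fun ω t => if m ≤ c ω t then 0 else δ ω t) := by
  have hA : MeasurableSet {z : Ω × ℝ | m ≤ c z.1 z.2} := measurableSet_le measurable_const hc
  have hmax : Measurable (Function.uncurry fun ω t => max (c ω t) m) := hc.max measurable_const
  have h1 : Measurable (Function.uncurry fun ω t => if m ≤ c ω t then δ ω t else 0) :=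
    Measurable.ite hA hδ measurable_const
  have h2 : Measurable (Function.uncurry fun ω t => if m ≤ c ω t then 0 else δ ω t) :=
    Measurable.ite hA measurable_const hδ
  have hone : Measurable (Function.uncurry fun (_ : Ω) (_ : ℝ) => m * (1 : ℝ)) := measurable_const
  rw [← pairR_smul_left P That kdot _ _ hm, pairR_eq_lintegral P That hk hmax hδ,
    pairR_eq_lintegral P That hk hc h1, pairR_eq_lintegral P That hk hone h2, ← lintegral_add_left]
  · refine lintegral_congr fun z => ?_
    by_cases h : m ≤ c z.1 z.2
    · simp [h]
    · simp [h, (not_le.mp h).le]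
  · exact hc.ennreal_ofReal.mul h1.ennreal_ofReal

/-- Abstract duality relations between the two-parameter primal domains `C(x,q)` and
dual domains `D(y,r)`:
(i) for `(x,q) ∈ K`, `C(x,q)` contains a strictly positive process and
`c ∈ C(x,q) ⟺ ⟨c,δ⟩ ≤ xy + qr` for all `(y,r) ∈ L*`, `δ ∈ D(y,r)`;
(ii) for `(y,r) ∈ L*`, `D(y,r)` contains a strictly positive process and
`δ ∈ D(y,r) ⟺ ⟨c,δ⟩ ≤ xy + qr` for all `(x,q) ∈ K`, `c ∈ C(x,q)`. -/
theorem two_parameter_duality_relations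
    [MeasurableSpace Ω] (P : Measure Ω) [IsProbabilityMeasure P]
    (That : EReal) (hThat : 0 < That)
    (kdot : Ω → ℝ → ℝ) (hkmeas : Measurable (Function.uncurry kdot))
    (hkpos : ∀ ω, ∀ t ∈ timeSet That, 0 < kdot ω t)
    (A : ℝ) (hkbdd : ∀ ω, (∫⁻ t in timeSet That, ENNReal.ofReal (kdot ω t)) ≤ ENNReal.ofReal A)
    (C D : Set (Ω → ℝ → ℝ))
    (hCamb : ∀ c ∈ C, (∀ ω t, 0 ≤ c ω t) ∧ Measurable (Function.uncurry c))
    (hDamb : ∀ δ ∈ D, (∀ ω t, 0 ≤ δ ω t) ∧ Measurable (Function.uncurry δ))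
    -- `C` and `D` are polar to each other
    (hCpolar : ∀ c : Ω → ℝ → ℝ, (∀ ω t, 0 ≤ c ω t) → Measurable (Function.uncurry c) →
      (c ∈ C ↔ ∀ δ ∈ D, pairR P That kdot c δ ≤ 1))
    (hDpolar : ∀ δ : Ω → ℝ → ℝ, (∀ ω t, 0 ≤ δ ω t) → Measurable (Function.uncurry δ) →
      (δ ∈ D ↔ ∀ c ∈ C, pairR P That kdot c δ ≤ 1))
    -- `D` contains a strictly positive element
    (hDpos : ∃ δ ∈ D, ∀ᵐ p ∂(Pkappa P That kdot), 0 < δ p.1 p.2)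
    -- `α = sup_{δ ∈ D} E[∫ δ dκ] ∈ (0,∞)`
    (α : ℝ) (hα : 0 < α)
    (hαdef : (⨆ δ ∈ D, pairR P That kdot (fun _ _ => 1) δ) = ENNReal.ofReal α)
    (lam : ℝ) (hlam : lam ∈ Set.Ioc (0:ℝ) 1) :
    let Cxq : ℝ → ℝ → Set (Ω → ℝ → ℝ) := fun x q =>
      {c | (∀ ω t, 0 ≤ c ω t) ∧ Measurable (Function.uncurry c) ∧
        ∃ c₀ ∈ C, ∀ ω t, max (c ω t) (lam * q) = x * c₀ ω t}
    let K : Set (ℝ × ℝ) := {p | 0 < p.1 ∧ p.2 < p.1 / (α * lam)}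
    let Lstar : Set (ℝ × ℝ) := {p | 0 < p.1 ∧ -(α * lam) * p.1 < p.2 ∧ p.2 ≤ 0}
    let Dyr : ℝ → ℝ → Set (Ω → ℝ → ℝ) := fun y r =>
      {δ | (∃ δ₀ ∈ D, ∀ ω t, δ ω t = y * δ₀ ω t) ∧
        ∀ p ∈ K, ∀ c ∈ Cxq p.1 p.2,
          pairR P That kdot c δ ≤ ENNReal.ofReal (p.1 * y + p.2 * r)}
    -- (i)
    ((∀ p ∈ K,
      (∃ c ∈ Cxq p.1 p.2, ∀ᵐ z ∂(Pkappa P That kdot), 0 < c z.1 z.2) ∧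
      ∀ c : Ω → ℝ → ℝ, (∀ ω t, 0 ≤ c ω t) → Measurable (Function.uncurry c) →
        (c ∈ Cxq p.1 p.2 ↔ ∀ p' ∈ Lstar, ∀ δ ∈ Dyr p'.1 p'.2,
          pairR P That kdot c δ ≤ ENNReal.ofReal (p.1 * p'.1 + p.2 * p'.2)))
    ∧
    -- (ii)
    (∀ p' ∈ Lstar,
      (∃ δ ∈ Dyr p'.1 p'.2, ∀ᵐ z ∂(Pkappa P That kdot), 0 < δ z.1 z.2) ∧
      ∀ δ : Ω → ℝ → ℝ, (∀ ω t, 0 ≤ δ ω t) → Measurable (Function.uncurry δ) →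
        (δ ∈ Dyr p'.1 p'.2 ↔ ∀ p ∈ K, ∀ c ∈ Cxq p.1 p.2,
          pairR P That kdot c δ ≤ ENNReal.ofReal (p.1 * p'.1 + p.2 * p'.2)))) := by
  intro Cxq K Lstar Dyr
  obtain ⟨hlam0, -⟩ := hlam
  have hαlam : 0 < α * lam := mul_pos hα hlam0
  have hpolar : ∀ c ∈ C, ∀ δ ∈ D, pairR P That kdot c δ ≤ 1 := fun c hc δ hδ =>
    (hCpolar c (hCamb c hc).1 (hCamb c hc).2).1 hc δ hδ
  have hDα : ∀ δ ∈ D, pairR P That kdot (fun _ _ => 1) δ ≤ ENNReal.ofReal α := fun δ hδ =>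
    hαdef ▸ le_iSup₂ (f := fun δ (_ : δ ∈ D) => pairR P That kdot (fun _ _ => 1) δ) δ hδ
  have hD_solid : ∀ δ ∈ D, ∀ δ' : Ω → ℝ → ℝ, (∀ ω t, 0 ≤ δ' ω t) →
      Measurable (Function.uncurry δ') → (∀ ω t, δ' ω t ≤ δ ω t) → δ' ∈ D :=
    fun δ hδ δ' h0 hm hle => (hDpolar δ' h0 hm).2 fun c hc =>
      (pairR_mono P That kdot (fun _ _ => le_rfl) hle).trans (hpolar c hc δ hδ)
  -- Splitting an element of `D` as `δ + η` puts `y • δ` in `D(y, r)` once `η` is large enough.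
  have hDyr : ∀ y r : ℝ, 0 < y → r ≤ 0 → ∀ δ η : Ω → ℝ → ℝ,
      (∀ ω t, 0 ≤ δ ω t) → (∀ ω t, 0 ≤ η ω t) → Measurable (Function.uncurry δ) →
      Measurable (Function.uncurry η) → (fun ω t => δ ω t + η ω t) ∈ D →
      ENNReal.ofReal (-r / (lam * y)) ≤ pairR P That kdot (fun _ _ => 1) η →
      (fun ω t => y * δ ω t) ∈ Dyr y r := by
    intro y r hy hr δ η hδ0 hη0 hδ hη hsum hrη
    refine ⟨⟨δ, hD_solid _ hsum δ hδ0 hδ fun ω t => by linarith [hη0 ω t], fun _ _ => rfl⟩, ?_⟩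
    rintro ⟨x, q⟩ ⟨hx, hq⟩ c ⟨hc0, hc, c₀, hc₀, hmax⟩
    simp only at hx hq hmax ⊢
    have hB : pairR P That kdot (fun ω t => max (c ω t) (lam * q)) (fun ω t => δ ω t + η ω t) ≤
        ENNReal.ofReal x := by
      simp only [hmax]
      rw [pairR_smul_left P That kdot _ _ hx.le]
      exact mul_le_of_le_one_right' (hpolar _ hc₀ _ hsum)
    rw [pairR_smul_right P That kdot _ _ hy.le]
    rcases le_total q 0 with h | h
    · calc _ ≤ ENNReal.ofReal y * ENNReal.ofReal x := by
            gcongr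
            refine (pairR_mono P That kdot (fun _ _ => le_max_left _ _) fun ω t => ?_).trans hB
            linarith [hη0 ω t]
        _ ≤ _ := by
            rw [← ENNReal.ofReal_mul hy.le]
            exact ENNReal.ofReal_le_ofReal (by nlinarith [mul_nonneg_of_nonpos_of_nonpos h hr])
    · have hb : 0 ≤ -r / (lam * y) := div_nonneg (by linarith) (by positivity)
      calc _ ≤ ENNReal.ofReal y * ENNReal.ofReal (x - lam * q * (-r / (lam * y))) := by
            gcongr
            exact pairR_le_sub_of_add P That hkmeas hc hδ hη hδ0 hη0 (by positivity) hb hB hrη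
        _ = _ := by
            rw [← ENNReal.ofReal_mul hy.le]
            congr 1
            field_simp
            ring
  refine ⟨?_, ?_⟩
  · rintro ⟨x, q⟩ ⟨hx, hq⟩
    have hpK : (x, q) ∈ K := ⟨hx, hq⟩
    simp only at hx hq ⊢
    refine ⟨⟨fun _ _ => x / α, ⟨fun _ _ => by positivity, measurable_const,
      fun _ _ => α⁻¹ * 1, ?_, ?_⟩, ?_⟩, ?_⟩
    · refine (hCpolar _ (fun _ _ => by positivity) measurable_const).2 fun δ hδ => ?_
      rw [pairR_smul_left P That kdot _ _ (by positivity)]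
      calc _ ≤ ENNReal.ofReal α⁻¹ * ENNReal.ofReal α := by gcongr; exact hDα δ hδ
        _ = 1 := by
          rw [← ENNReal.ofReal_mul (by positivity), inv_mul_cancel₀ hα.ne', ENNReal.ofReal_one]
    · intro _ _
      rw [max_eq_left, mul_one, div_eq_mul_inv]
      rw [lt_div_iff₀ hαlam] at hq
      rw [le_div_iff₀ hα]
      linarith
    · exact Eventually.of_forall fun _ => by positivity
    · intro c hc0 hc
      refine ⟨fun h p' _ δ hδ => hδ.2 (x, q) hpK c h, fun h => ?_⟩
      have hmaxm : Measurable (Function.uncurry fun ω t => max (c ω t) (lam * q)) :=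
        hc.max measurable_const
      suffices hle : ∀ δ ∈ D, pairR P That kdot (fun ω t => max (c ω t) (lam * q)) δ ≤
          ENNReal.ofReal x by
        refine ⟨hc0, hc, fun ω t => x⁻¹ * max (c ω t) (lam * q), ?_,
          fun ω t => (mul_inv_cancel_left₀ hx.ne' _).symm⟩
        refine (hCpolar _ (fun ω t => mul_nonneg (by positivity) (le_max_of_le_left (hc0 ω t)))
          (hmaxm.const_mul _)).2 fun δ hδ => ?_
        rw [pairR_smul_left P That kdot _ _ (by positivity)]
        calc _ ≤ ENNReal.ofReal x⁻¹ * ENNReal.ofReal x := by gcongr; exact hle δ hδ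
          _ = 1 := by
            rw [← ENNReal.ofReal_mul (by positivity), inv_mul_cancel₀ hx.ne', ENNReal.ofReal_one]
      intro δ hδ
      obtain ⟨hδ0, hδm⟩ := hDamb δ hδ
      rcases le_total q 0 with hq0 | hq0
      · have hmem : (fun ω t => (1 : ℝ) * δ ω t) ∈ Dyr 1 0 :=
          hDyr 1 0 one_pos le_rfl δ (fun _ _ => 0) hδ0 (fun _ _ => le_rfl) hδm measurable_const
            (by simpa using hδ) (by simp)
        have hmax : ∀ ω t, max (c ω t) (lam * q) = c ω t := fun ω t =>
          max_eq_left ((mul_nonpos_of_nonneg_of_nonpos hlam0.le hq0).trans (hc0 ω t))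
        have hL : ((1 : ℝ), (0 : ℝ)) ∈ Lstar := ⟨one_pos, by simpa using hαlam, le_rfl⟩
        simpa [hmax] using h (1, 0) hL _ hmem
      · have hm : 0 ≤ lam * q := mul_nonneg hlam0.le hq0
        have hA : MeasurableSet {z : Ω × ℝ | lam * q ≤ c z.1 z.2} :=
          measurableSet_le measurable_const hc
        have hδ₁m : Measurable
            (Function.uncurry fun ω t => if lam * q ≤ c ω t then δ ω t else 0) :=
          Measurable.ite hA hδm measurable_const
        have hηm : Measurable
            (Function.uncurry fun ω t => if lam * q ≤ c ω t then 0 else δ ω t) :=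
          Measurable.ite hA measurable_const hδm
        rw [pairR_max_eq P That hkmeas hc hδm hm]
        set δ₁ : Ω → ℝ → ℝ := fun ω t => if lam * q ≤ c ω t then δ ω t else 0 with hδ₁
        set η : Ω → ℝ → ℝ := fun ω t => if lam * q ≤ c ω t then 0 else δ ω t with hη
        have hδ₁0 : ∀ ω t, 0 ≤ δ₁ ω t := fun ω t => by
          simp only [hδ₁]; split_ifs <;> simp [hδ0]
        have hη0 : ∀ ω t, 0 ≤ η ω t := fun ω t => by
          simp only [hη]; split_ifs <;> simp [hδ0]
        have hηle : pairR P That kdot (fun _ _ => 1) η ≤ ENNReal.ofReal α := by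
          refine (pairR_mono P That kdot (fun _ _ => le_rfl) fun ω t => ?_).trans (hDα δ hδ)
          simp only [hη]; split_ifs <;> simp [hδ0]
        have hsum : (fun ω t => δ₁ ω t + η ω t) = δ := by
          funext ω t
          simp only [hδ₁, hη]; split_ifs <;> simp
        obtain ⟨b, hb0, hb⟩ : ∃ b : ℝ, 0 ≤ b ∧
            pairR P That kdot (fun _ _ => 1) η = ENNReal.ofReal b :=
          ⟨_, ENNReal.toReal_nonneg,
            (ENNReal.ofReal_toReal (ne_top_of_le_ne_top ENNReal.ofReal_ne_top hηle)).symm⟩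
        have hbα : b ≤ α := (ENNReal.ofReal_le_ofReal_iff hα.le).1 (hb ▸ hηle)
        rw [hb, ← ENNReal.ofReal_mul hm]
        -- `(1, -λ b)` may lie on the boundary of `Lstar`, so approach it from inside.
        have hstep : ∀ s ∈ Ioo (0 : ℝ) 1,
            pairR P That kdot c δ₁ ≤ ENNReal.ofReal (x - lam * q * (s * b)) := by
          rintro s ⟨hs, hs1⟩
          have hr : -(lam * (s * b)) ≤ 0 :=
            neg_nonpos.2 (mul_nonneg hlam0.le (mul_nonneg hs.le hb0))
          have hsb : s * b ≤ b := mul_le_of_le_one_left hb0 hs1.le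
          have hsbα : s * b < α := by
            calc s * b ≤ s * α := by gcongr
              _ < α := mul_lt_of_lt_one_left hα hs1
          have hmem : (fun ω t => (1 : ℝ) * δ₁ ω t) ∈ Dyr 1 (-(lam * (s * b))) := by
            refine hDyr 1 _ one_pos hr δ₁ η hδ₁0 hη0 hδ₁m hηm (hsum ▸ hδ) ?_
            rw [hb, neg_neg, mul_one, mul_div_cancel_left₀ _ hlam0.ne']
            exact ENNReal.ofReal_le_ofReal hsb
          have hL : ((1 : ℝ), -(lam * (s * b))) ∈ Lstar := by
            refine ⟨one_pos, ?_, hr⟩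
            simp only [mul_one]
            nlinarith
          have hle := h _ hL _ hmem
          simp only [one_mul, mul_one] at hle
          exact hle.trans (ENNReal.ofReal_le_ofReal (le_of_eq (by ring)))
        have hlim : pairR P That kdot c δ₁ ≤ ENNReal.ofReal (x - lam * q * (1 * b)) := by
          have hcont : Continuous fun s : ℝ => ENNReal.ofReal (x - lam * q * (s * b)) :=
            ENNReal.continuous_ofReal.comp (by fun_prop)
          refine ge_of_tendsto ((hcont.tendsto 1).mono_left
            (nhdsWithin_le_nhds (s := Iio 1))) ?_
          filter_upwards [Ioo_mem_nhdsLT (zero_lt_one' ℝ)] with s hs using hstep s hs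
        rw [one_mul] at hlim
        rw [lt_div_iff₀ hαlam] at hq
        calc _ ≤ ENNReal.ofReal (x - lam * q * b) + ENNReal.ofReal (lam * q * b) := by gcongr
          _ = ENNReal.ofReal x := by
            rw [← ENNReal.ofReal_add _ (mul_nonneg hm hb0), sub_add_cancel]
            nlinarith [mul_le_mul_of_nonneg_left hbα hm]
  · rintro ⟨y, r⟩ ⟨hy, hr, hr0⟩
    simp only at hy hr hr0 ⊢
    refine ⟨?_, ?_⟩
    · obtain ⟨δb, hδb, hδbpos⟩ := hDpos
      have hβ0 : 0 ≤ -r / (lam * y) := div_nonneg (by linarith) (by positivity)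
      have hβα : -r / (lam * y) < α := by
        rw [div_lt_iff₀ (by positivity)]
        linarith
      set β := -r / (lam * y)
      obtain ⟨s, hβs, hsα⟩ := exists_between hβα
      have hs0 : 0 < s := hβ0.trans_lt hβs
      obtain ⟨δa, hδa, hsa⟩ : ∃ δa ∈ D,
          ENNReal.ofReal s < pairR P That kdot (fun _ _ => 1) δa := by
        have : ENNReal.ofReal s < ⨆ δ ∈ D, pairR P That kdot (fun _ _ => 1) δ :=
          hαdef ▸ (ENNReal.ofReal_lt_ofReal_iff hα).2 hsα
        simpa [lt_iSup_iff] using this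
      obtain ⟨ha0, ham⟩ := hDamb δa hδa
      obtain ⟨hb0, hbm⟩ := hDamb δb hδb
      have hu0 : 0 ≤ β / s := by positivity
      have hu1 : 0 < 1 - β / s := sub_pos.2 ((div_lt_one hs0).2 hβs)
      have hm1 : Measurable (Function.uncurry fun ω t => (1 - β / s) * δb ω t) :=
        hbm.const_mul _
      have hm2 : Measurable (Function.uncurry fun ω t => (β / s) * δa ω t) := ham.const_mul _
      have h01 : ∀ ω t, 0 ≤ (1 - β / s) * δb ω t := fun ω t => mul_nonneg hu1.le (hb0 ω t)
      have h02 : ∀ ω t, 0 ≤ (β / s) * δa ω t := fun ω t => mul_nonneg hu0 (ha0 ω t)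
      refine ⟨fun ω t => y * ((1 - β / s) * δb ω t),
        hDyr y r hy hr0 _ (fun ω t => (β / s) * δa ω t) h01 h02 hm1 hm2 ?_ ?_, ?_⟩
      · refine (hDpolar _ (fun ω t => add_nonneg (h01 ω t) (h02 ω t)) (hm1.add hm2)).2
          fun c hc => ?_
        rw [pairR_add_right P That hkmeas (hCamb c hc).2 hm1 hm2 h01 h02,
          pairR_smul_right P That kdot _ _ hu1.le, pairR_smul_right P That kdot _ _ hu0]
        calc _ ≤ ENNReal.ofReal (1 - β / s) * 1 + ENNReal.ofReal (β / s) * 1 := by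
              gcongr
              · exact hpolar c hc δb hδb
              · exact hpolar c hc δa hδa
          _ = 1 := by
              rw [mul_one, mul_one, ← ENNReal.ofReal_add hu1.le hu0, sub_add_cancel,
                ENNReal.ofReal_one]
      · rw [pairR_smul_right P That kdot _ _ hu0]
        calc ENNReal.ofReal β = ENNReal.ofReal (β / s) * ENNReal.ofReal s := by
              rw [← ENNReal.ofReal_mul hu0, div_mul_cancel₀ _ hs0.ne']
          _ ≤ _ := by gcongr
      · filter_upwards [hδbpos] with z hz
        positivity
    · intro δ hδ0 hδ
      refine ⟨fun h p hp c hc => h.2 p hp c hc, fun h => ⟨⟨fun ω t => y⁻¹ * δ ω t, ?_,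
        fun ω t => (mul_inv_cancel_left₀ hy.ne' _).symm⟩, h⟩⟩
      refine (hDpolar _ (fun ω t => mul_nonneg (by positivity) (hδ0 ω t)) (hδ.const_mul _)).2
        fun c hc => ?_
      obtain ⟨hc0, hcm⟩ := hCamb c hc
      have hK : ((1 : ℝ), (0 : ℝ)) ∈ K := ⟨one_pos, one_div_pos.2 hαlam⟩
      have hcx : c ∈ Cxq 1 0 := ⟨hc0, hcm, c, hc, fun ω t => by simp [hc0 ω t]⟩
      have := h _ hK c hcx
      simp only [one_mul, zero_mul, add_zero] at this
      rw [pairR_smul_right P That kdot _ _ (by positivity)]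
      calc _ ≤ ENNReal.ofReal y⁻¹ * ENNReal.ofReal y := by gcongr
        _ = 1 := by
          rw [← ENNReal.ofReal_mul (by positivity), inv_mul_cancel₀ hy.ne', ENNReal.ofReal_one]
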